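/- Let A be a commutative complex Banach algebra with unit, and let a be an orthogonal unit of the Wiener algebra W(A) with inverse b, and let Π_n = a(n)·b(−n). Then b is also orthogonal (b(n)·b(m)=0 for n ≠ m), and b is subordinated to the reflected family: Π_{−n}·b(m) = b(m) if n = m and Π_{−n}·b(m) = 0 if n ≠ m; moreover, the idempotent family of b is given by b(n)·a(−n) = Π_{−n} for all n ∈ ℤ. -/

import Mathlib

open scoped BigOperators

/-- A function `a : ℤ → A` is rapidly decreasing if for every `k` the quantities
`(1+|n|)^k * ‖a n‖` are bounded. -/
def RapidlyDecreasing {A : Type*} [NormedRing A] (a : ℤ → A) : Prop :=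
  ∀ k : ℕ, ∃ C : ℝ, ∀ n : ℤ, (1 + |(n : ℝ)|) ^ k * ‖a n‖ ≤ C

/-- The convolution product of the Wiener algebra `W(A)`:
`(a*b)(n) = ∑_{m∈ℤ} a(m)·b(n−m)`. -/
noncomputable def conv {A : Type*} [NormedRing A] (a b : ℤ → A) : ℤ → A :=
  fun n => ∑' m : ℤ, a m * b (n - m)

/-- The multiplicative unit `e` of the Wiener algebra: `e(0)=1`, `e(n)=0` for `n≠0`. -/
def wone {A : Type*} [NormedRing A] : ℤ → A := fun n => if n = 0 then 1 else 0

/-- `a` is a unit of the Wiener algebra `W(A)`. -/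
def IsWienerUnit {A : Type*} [NormedRing A] (a : ℤ → A) : Prop :=
  RapidlyDecreasing a ∧ ∃ b : ℤ → A, RapidlyDecreasing b ∧ conv a b = wone

/-- `a` is strictly holomorphic: `a(0)=1` and `a(n)=0` for `n<0`. -/
def StrictlyHolomorphic {A : Type*} [NormedRing A] (a : ℤ → A) : Prop :=
  a 0 = 1 ∧ ∀ n : ℤ, n < 0 → a n = 0

/-- `a` is strictly antiholomorphic: `a(0)=1` and `a(n)=0` for `n>0`. -/
def StrictlyAntiholomorphic {A : Type*} [NormedRing A] (a : ℤ → A) : Prop :=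
  a 0 = 1 ∧ ∀ n : ℤ, 0 < n → a n = 0

/-- `a` is an orthogonal Laurent series: `a(n)·a(m)=0` whenever `n≠m`. -/
def OrthogonalSeq {A : Type*} [NormedRing A] (a : ℤ → A) : Prop :=
  ∀ n m : ℤ, n ≠ m → a n * a m = 0

theorem RapidlyDecreasing.summable_norm {A : Type*} [NormedRing A] {a : ℤ → A}
    (ha : RapidlyDecreasing a) : Summable fun n => ‖a n‖ := by
  obtain ⟨C, hC⟩ := ha 2
  have hnat : Summable fun n : ℕ => 1 / (1 + (n : ℝ)) ^ 2 := by
    have h := (summable_nat_add_iff 1).2 (Real.summable_one_div_nat_pow.2 one_lt_two)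
    refine h.congr fun n => ?_
    push_cast
    rw [add_comm]
  have hint : Summable fun n : ℤ => 1 / (1 + |(n : ℝ)|) ^ 2 :=
    Summable.of_nat_of_neg (by simpa using hnat) (by simpa using hnat)
  refine Summable.of_nonneg_of_le (fun n => norm_nonneg _) (fun n => ?_) (hint.mul_left C)
  rw [mul_one_div, le_div_iff₀ (by positivity), mul_comm]
  exact hC n

theorem RapidlyDecreasing.hasSum_conv {A : Type*} [NormedRing A] [CompleteSpace A]
    {a b : ℤ → A} (ha : RapidlyDecreasing a) (hb : RapidlyDecreasing b) (n : ℤ) :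
    HasSum (fun m => a m * b (n - m)) (conv a b n) := by
  obtain ⟨C, hC⟩ := hb 0
  refine Summable.hasSum (Summable.of_norm_bounded (ha.summable_norm.mul_right C) fun m => ?_)
  refine (norm_mul_le _ _).trans (mul_le_mul_of_nonneg_left ?_ (norm_nonneg _))
  simpa using hC (n - m)

/-- Multiplying a convolution by a factor that annihilates all but one summand. -/
theorem RapidlyDecreasing.mul_conv_eq {A : Type*} [NormedRing A] [CompleteSpace A]
    {a b : ℤ → A} (ha : RapidlyDecreasing a) (hb : RapidlyDecreasing b) {n k : ℤ} {x : A}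
    (hx : ∀ m, m ≠ k → x * (a m * b (n - m)) = 0) :
    x * conv a b n = x * (a k * b (n - k)) :=
  ((ha.hasSum_conv hb n).mul_left x).unique (hasSum_single k hx)

/-- If `a` is an orthogonal unit of `W(A)` with inverse `b` and
`Π_n = a(n)·b(−n)`, then `b` is orthogonal, `b` is subordinated to the reflected family
(`Π_{−n}·b(m) = δ_{n,m}·b(m)`), and the idempotent family of `b` is
`b(n)·a(−n) = Π_{−n}`. -/
theorem orthogonal_inverse {A : Type*} [NormedCommRing A] [NormedAlgebra ℂ A]
    [CompleteSpace A] (a b : ℤ → A)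
    (ha : RapidlyDecreasing a) (horth : OrthogonalSeq a)
    (hb : RapidlyDecreasing b) (hab : conv a b = wone) :
    OrthogonalSeq b ∧
    (∀ n m : ℤ, (a (-n) * b n) * b m = if n = m then b m else 0) ∧
    (∀ n : ℤ, b n * a (-n) = a (-n) * b n) := by
  have haab (k n : ℤ) : a k * (a k * b (n - k)) = if n = 0 then a k else 0 := by
    rw [← ha.mul_conv_eq hb fun m hm => by rw [← mul_assoc, horth k m hm.symm, zero_mul], hab]
    simp [wone]
  have haa (k : ℤ) : a k * (a k * b (-k)) = a k := by simpa using haab k 0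
  have hab_zero (k j : ℤ) (hj : j ≠ -k) : a k * b j = 0 := by
    have h := haab k (j + k)
    rw [add_sub_cancel_right, if_neg (by omega)] at h
    calc a k * b j = (a k * (a k * b (-k))) * b j := by rw [haa]
      _ = (a k * (a k * b j)) * b (-k) := by ring
      _ = 0 := by rw [h, zero_mul]
  have hbb (j : ℤ) : a (-j) * b j * b j = b j := by
    have h := ha.mul_conv_eq hb (n := 0) (k := -j) (x := b j) fun m hm => by
      rw [← mul_assoc, mul_comm (b j), hab_zero m j (by omega), zero_mul]
    rw [hab] at h
    simp only [wone, if_true, mul_one, zero_sub, neg_neg] at h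
    rw [mul_comm, ← h]
  refine ⟨fun n m hnm => ?_, fun n m => ?_, fun n => mul_comm _ _⟩
  · calc b n * b m = (a (-n) * b n * b n) * b m := by rw [hbb]
      _ = (a (-n) * b m) * (b n * b n) := by ring
      _ = 0 := by rw [hab_zero (-n) m (by omega), zero_mul]
  · split_ifs with h
    · rw [← h, hbb]
    · rw [mul_right_comm, hab_zero (-n) m (by omega), zero_mul]
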